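/- Let W(Y) = Y - exp(Y). For |ζ| = 1 and k ∈ ℤ let L_k(ζ) denote the set of points p ∈ ℂ such that there exists a differentiable map φ : ℝ → ℂ with φ(0) = p, φ'(x) = ζ · conj(W'(φ(x))) for all x ≤ 0, and φ(x) → 2πik as x → -∞. Then for all θ, θ' ∈ (0, π/2) and all integers k, l, the intersection L_k(e^{-iθ'}) ∩ L_l(e^{iθ}) consists of exactly one point if k = l or k = l + 1, and is empty otherwise. -/

import Mathlib

open Complex Filter

/-- The superpotential `W(Y) = Y - exp Y`. -/
noncomputable def Wfc : ℂ → ℂ := fun Y => Y - Complex.exp Y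

/-- The left Lefschetz thimble `L_k(ζ)` of the critical point `Y_k = 2πik`:
points `p` reached at time `0` by a solution of `φ'(x) = ζ · conj (W'(φ x))` (for `x ≤ 0`)
emanating from `2πik` in the infinite past. -/
def Thimble (k : ℤ) (ζ : ℂ) : Set ℂ :=
  {p : ℂ | ∃ φ : ℝ → ℂ, φ 0 = p ∧
    (∀ x : ℝ, x ≤ 0 → HasDerivAt φ (ζ * (starRingEnd ℂ) (deriv Wfc (φ x))) x) ∧
    Tendsto φ atBot (nhds ((2 : ℂ) * (Real.pi : ℂ) * Complex.I * (k : ℂ)))}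


/-- For `y ∈ (b, π)`, the real number `Re (1 + W (x + iy))` at the unique `x` for which
`Im W (x + iy) = b`. -/
noncomputable def levelRe (b y : ℝ) : ℝ :=
  Real.log ((y - b) / Real.sin y) - (y - b) * Real.cos y / Real.sin y + 1

lemma Wfc_re (Y : ℂ) : (Wfc Y).re = Y.re - Real.exp Y.re * Real.cos Y.im := by
  simp [Wfc, Complex.exp_re]

lemma Wfc_im (Y : ℂ) : (Wfc Y).im = Y.im - Real.exp Y.re * Real.sin Y.im := by
  simp [Wfc, Complex.exp_im]

lemma hasStrictDerivAt_Wfc (Y : ℂ) : HasStrictDerivAt Wfc (1 - Complex.exp Y) Y :=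
  (hasStrictDerivAt_id Y).sub (Complex.hasStrictDerivAt_exp Y)

lemma deriv_Wfc (Y : ℂ) : deriv Wfc Y = 1 - Complex.exp Y :=
  (hasStrictDerivAt_Wfc Y).hasDerivAt.deriv

lemma Wfc_add_two_pi_mul_I (Y : ℂ) (k : ℤ) :
    Wfc (Y + 2 * Real.pi * I * k) = Wfc Y + 2 * Real.pi * I * k := by
  have : Complex.exp (Y + 2 * Real.pi * I * k) = Complex.exp Y := by
    rw [show (2 * Real.pi * I * k : ℂ) = k * (2 * Real.pi * I) by ring]
    exact Complex.exp_periodic.int_mul k Y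
  simp only [Wfc, this]; ring

lemma Wfc_conj (Y : ℂ) : Wfc ((starRingEnd ℂ) Y) = (starRingEnd ℂ) (Wfc Y) := by
  simp [Wfc, Complex.exp_conj]

lemma hasDerivAt_levelRe {b y : ℝ} (hb : 0 < b) (hy : y ∈ Set.Ioo b Real.pi) :
    HasDerivAt (levelRe b)
      ((((y - b) / Real.sin y - Real.cos y) ^ 2 + Real.sin y ^ 2) / (y - b)) y := by
  have hu : 0 < y - b := sub_pos.2 hy.1
  have hs : 0 < Real.sin y := Real.sin_pos_of_pos_of_lt_pi (hb.trans hy.1) hy.2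
  have h1 : HasDerivAt (fun y : ℝ => y - b) 1 y := (hasDerivAt_id y).sub_const b
  have h := ((h1.div (Real.hasDerivAt_sin y) hs.ne').log (div_pos hu hs).ne').sub
    ((h1.mul (Real.hasDerivAt_cos y)).div (Real.hasDerivAt_sin y) hs.ne') |>.add_const 1
  refine h.congr_deriv ?_
  simp only [Pi.mul_apply, Pi.div_apply]
  have hc := Real.sin_sq_add_cos_sq y
  field_simp
  generalize Real.sin y = s at *
  generalize Real.cos y = c at *
  have : c ^ 2 = 1 - s ^ 2 := by linarith
  ring_nf
  simp only [this]
  ring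

lemma levelRe_strictMonoOn {b : ℝ} (hb : 0 < b) :
    StrictMonoOn (levelRe b) (Set.Ioo b Real.pi) := by
  refine strictMonoOn_of_deriv_pos (convex_Ioo _ _)
    (fun y hy => (hasDerivAt_levelRe hb hy).continuousAt.continuousWithinAt) fun y hy => ?_
  rw [interior_Ioo] at hy
  rw [(hasDerivAt_levelRe hb hy).deriv]
  have hs : 0 < Real.sin y := Real.sin_pos_of_pos_of_lt_pi (hb.trans hy.1) hy.2
  have hu : 0 < y - b := sub_pos.2 hy.1
  positivity

lemma exists_levelRe_eq {b : ℝ} (hb : 0 < b) (hbπ : b < Real.pi) (a : ℝ) :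
    ∃ y ∈ Set.Ioo b Real.pi, levelRe b y = a := by
  have hsb : 0 < Real.sin b := Real.sin_pos_of_pos_of_lt_pi hb hbπ
  have hbot : Tendsto (levelRe b) (nhdsWithin b (Set.Ioo b Real.pi)) atBot := by
    have hc : ContinuousAt (fun y : ℝ => (y - b) / Real.sin y) b :=
      ContinuousAt.div (by fun_prop) (by fun_prop) hsb.ne'
    have h1 : Tendsto (fun y : ℝ => (y - b) / Real.sin y) (nhdsWithin b (Set.Ioo b Real.pi))
        (nhdsWithin 0 (Set.Ioi 0)) := by
      refine tendsto_nhdsWithin_iff.2 ⟨?_, ?_⟩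
      · simpa using hc.tendsto.mono_left nhdsWithin_le_nhds
      · filter_upwards [self_mem_nhdsWithin] with y hy
        exact div_pos (sub_pos.2 hy.1) (Real.sin_pos_of_pos_of_lt_pi (hb.trans hy.1) hy.2)
    have h2 : ContinuousAt (fun y : ℝ => - ((y - b) * Real.cos y / Real.sin y)) b :=
      (ContinuousAt.div (by fun_prop) (by fun_prop) hsb.ne').neg
    have h3 := (Real.tendsto_log_nhdsGT_zero.comp h1).atBot_add
      (h2.tendsto.mono_left nhdsWithin_le_nhds)
    exact (h3.atBot_add (tendsto_const_nhds (x := (1 : ℝ)))).congr fun y => by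
      simp [levelRe]; ring
  have htop : Tendsto (levelRe b) (nhdsWithin Real.pi (Set.Ioo b Real.pi)) atTop := by
    have hs : Tendsto Real.sin (nhdsWithin Real.pi (Set.Ioo b Real.pi))
        (nhdsWithin 0 (Set.Ioi 0)) := by
      refine tendsto_nhdsWithin_iff.2 ⟨?_, ?_⟩
      · simpa using (Real.continuous_sin.tendsto Real.pi).mono_left nhdsWithin_le_nhds
      · filter_upwards [self_mem_nhdsWithin] with y hy
        exact Real.sin_pos_of_pos_of_lt_pi (hb.trans hy.1) hy.2
    have h1 : Tendsto (fun y : ℝ => (y - b) / Real.sin y)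
        (nhdsWithin Real.pi (Set.Ioo b Real.pi)) atTop := by
      have hu : ContinuousAt (fun y : ℝ => y - b) Real.pi := by fun_prop
      exact (hu.tendsto.mono_left nhdsWithin_le_nhds).pos_mul_atTop (sub_pos.2 hbπ)
        (tendsto_inv_nhdsGT_zero.comp hs)
    have h2 : Tendsto (fun y : ℝ => - Real.cos y)
        (nhdsWithin Real.pi (Set.Ioo b Real.pi)) (nhds 1) := by
      have hc : Continuous fun y : ℝ => - Real.cos y := by fun_prop
      simpa using (hc.tendsto Real.pi).mono_left nhdsWithin_le_nhds
    have h3 := ((Real.tendsto_log_atTop.comp h1).atTop_add_atTop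
      (h1.atTop_mul_pos one_pos h2)).atTop_add (tendsto_const_nhds (x := (1 : ℝ)))
    exact h3.congr fun y => by simp [levelRe]; ring
  have : (nhdsWithin b (Set.Ioo b Real.pi)).NeBot := left_nhdsWithin_Ioo_neBot hbπ
  have : (nhdsWithin Real.pi (Set.Ioo b Real.pi)).NeBot := right_nhdsWithin_Ioo_neBot hbπ
  have := isPreconnected_Ioo.intermediate_value_Iii
    (le_principal_iff.2 self_mem_nhdsWithin) (le_principal_iff.2 self_mem_nhdsWithin)
    (fun y hy => (hasDerivAt_levelRe hb hy).continuousAt.continuousWithinAt) hbot htop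
    (Set.mem_univ a)
  exact this

lemma im_lt_pi_of_Wfc_im_lt_pi {Y : ℂ} (h : (Wfc Y).im < Real.pi)
    (hY : Y.im < 2 * Real.pi) : Y.im < Real.pi := by
  by_contra! hc
  have : Real.sin Y.im ≤ 0 := by
    rw [← neg_nonneg, ← Real.sin_sub_pi]
    exact Real.sin_nonneg_of_nonneg_of_le_pi (by linarith) (by linarith)
  rw [Wfc_im] at h
  nlinarith [Real.exp_pos Y.re]

lemma existsUnique_Wfc_eq_of_im_lt_pi {w : ℂ} (h0 : 0 < w.im) (h1 : w.im < Real.pi) :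
    ∃! Y : ℂ, Y.im ∈ Set.Ioo 0 (2 * Real.pi) ∧ Wfc Y = w := by
  have key : ∀ Y : ℂ, Y.im ∈ Set.Ioo 0 (2 * Real.pi) → Wfc Y = w →
      Y.im ∈ Set.Ioo w.im Real.pi ∧
      Y.re = Real.log ((Y.im - w.im) / Real.sin Y.im) ∧ levelRe w.im Y.im = w.re + 1 := by
    rintro Y ⟨hY0, hY1⟩ rfl
    have him := Wfc_im Y
    have hre := Wfc_re Y
    have he := Real.exp_pos Y.re
    have hlt : Y.im < Real.pi := im_lt_pi_of_Wfc_im_lt_pi h1 hY1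
    have hs : 0 < Real.sin Y.im := Real.sin_pos_of_pos_of_lt_pi hY0 hlt
    have hq : (Y.im - (Wfc Y).im) / Real.sin Y.im = Real.exp Y.re := by
      rw [him]; field_simp; ring
    have hq' : (Y.im - (Wfc Y).im) * Real.cos Y.im / Real.sin Y.im
        = Real.exp Y.re * Real.cos Y.im := by
      rw [← hq]; ring
    refine ⟨⟨by nlinarith, hlt⟩, by rw [hq, Real.log_exp], ?_⟩
    rw [levelRe, hq, hq', Real.log_exp, hre]
  obtain ⟨y, hy, hya⟩ := exists_levelRe_eq h0 h1 (w.re + 1)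
  have hs : 0 < Real.sin y := Real.sin_pos_of_pos_of_lt_pi (h0.trans hy.1) hy.2
  refine ⟨⟨Real.log ((y - w.im) / Real.sin y), y⟩,
    ⟨⟨h0.trans hy.1, by linarith [hy.2, h0.trans h1]⟩, ?_⟩, ?_⟩
  · have hexp := Real.exp_log (div_pos (sub_pos.2 hy.1) hs)
    rw [levelRe] at hya
    apply Complex.ext
    · rw [Wfc_re]
      simp only [hexp]
      rw [div_mul_eq_mul_div]
      linarith
    · rw [Wfc_im]
      simp only [hexp]
      field_simp
      ring
  · rintro Y ⟨hY, hW⟩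
    obtain ⟨h1, h2, h3⟩ := key Y hY hW
    have : Y.im = y := (levelRe_strictMonoOn h0).injOn h1 hy (h3.trans hya.symm)
    apply Complex.ext
    · rw [h2, this]
    · exact this

/-- `W` restricts to a bijection onto the strip `0 < Im w < 2π` from a subset of the strip
`0 < Im Y < 2π`. -/
lemma existsUnique_Wfc_eq {w : ℂ} (h0 : 0 < w.im) (h1 : w.im < 2 * Real.pi) :
    ∃! Y : ℂ, Y.im ∈ Set.Ioo 0 (2 * Real.pi) ∧ Wfc Y = w := by
  rcases lt_trichotomy w.im Real.pi with h | h | h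
  · exact existsUnique_Wfc_eq_of_im_lt_pi h0 h
  · have hmono : StrictMono fun x : ℝ => x + Real.exp x :=
      strictMono_id.add Real.exp_strictMono
    have hsurj : Function.Surjective fun x : ℝ => x + Real.exp x := by
      refine Continuous.surjective (by fun_prop) ?_ ?_
      · exact tendsto_id.atTop_add_atTop Real.tendsto_exp_atTop
      · exact tendsto_id.atBot_add Real.tendsto_exp_atBot
    obtain ⟨x, hx⟩ := hsurj w.re
    refine ⟨⟨x, Real.pi⟩, ⟨⟨Real.pi_pos, by simp; linarith [Real.pi_pos]⟩, ?_⟩, ?_⟩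
    · apply Complex.ext
      · simpa [Wfc_re] using hx
      · simp [Wfc_im, h]
    · rintro Y ⟨⟨hY0, hY1⟩, hW⟩
      have him := Wfc_im Y
      have hre := Wfc_re Y
      rw [hW] at him hre
      have he := Real.exp_pos Y.re
      have hy : Y.im = Real.pi := by
        rcases lt_trichotomy Y.im Real.pi with hc | hc | hc
        · have := Real.sin_pos_of_pos_of_lt_pi hY0 hc
          nlinarith
        · exact hc
        · have : 0 < Real.sin (Y.im - Real.pi) :=
            Real.sin_pos_of_pos_of_lt_pi (by linarith) (by linarith)
          rw [Real.sin_sub_pi] at this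
          nlinarith
      apply Complex.ext
      · apply hmono.injective
        simp only [hy, Real.cos_pi] at hre
        simp only at hx ⊢
        linarith
      · exact hy
  · have hW : ∀ Y : ℂ, Wfc ((starRingEnd ℂ) Y + 2 * Real.pi * I)
        = (starRingEnd ℂ) (Wfc Y) + 2 * Real.pi * I := fun Y => by
      simpa [Wfc_conj] using Wfc_add_two_pi_mul_I ((starRingEnd ℂ) Y) 1
    have hinv : ∀ Y : ℂ, (starRingEnd ℂ) ((starRingEnd ℂ) Y + 2 * Real.pi * I)
        + 2 * Real.pi * I = Y := fun Y => by simp [Complex.conj_ofNat]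
    obtain ⟨Y, ⟨hY, hYW⟩, huniq⟩ := existsUnique_Wfc_eq_of_im_lt_pi
      (w := (starRingEnd ℂ) w + 2 * Real.pi * I) (by simpa using h1)
      (by simp; linarith)
    refine ⟨(starRingEnd ℂ) Y + 2 * Real.pi * I, ⟨⟨?_, ?_⟩, ?_⟩, ?_⟩
    · simpa using hY.2
    · simpa using hY.1
    · rw [hW, hYW, hinv]
    · rintro Z ⟨⟨hZ0, hZ1⟩, hZW⟩
      rw [← huniq ((starRingEnd ℂ) Z + 2 * Real.pi * I)
        ⟨⟨by simpa using hZ1, by simpa using hZ0⟩, by rw [hW, hZW]⟩, hinv]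

lemma Wfc_two_pi_mul_I (k : ℤ) : Wfc (2 * Real.pi * I * k) = -1 + 2 * Real.pi * I * k := by
  simpa [Wfc] using Wfc_add_two_pi_mul_I 0 k

lemma mem_Thimble_self (k : ℤ) (ζ : ℂ) : 2 * Real.pi * I * k ∈ Thimble k ζ := by
  refine ⟨fun _ => 2 * Real.pi * I * k, rfl, fun x _ => ?_, tendsto_const_nhds⟩
  have h : Complex.exp (2 * Real.pi * I * k) = 1 := by
    rw [show (2 * Real.pi * I * k : ℂ) = k * (2 * Real.pi * I) by ring]
    exact Complex.exp_int_mul_two_pi_mul_I k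
  simpa [deriv_Wfc, h] using hasDerivAt_const x (2 * Real.pi * I * k : ℂ)

lemma add_mem_Thimble {ζ p : ℂ} (hp : p ∈ Thimble 0 ζ) (k : ℤ) :
    p + 2 * Real.pi * I * k ∈ Thimble k ζ := by
  obtain ⟨φ, h0, hφ, hlim⟩ := hp
  refine ⟨fun x => φ x + 2 * Real.pi * I * k, by simp [h0], fun x hx => ?_, ?_⟩
  · refine ((hφ x hx).add_const _).congr_deriv ?_
    rw [deriv_Wfc, deriv_Wfc, show (2 * Real.pi * I * k : ℂ) = k * (2 * Real.pi * I) by ring,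
      Complex.exp_periodic.int_mul k]
  · simpa using hlim.add_const (2 * Real.pi * I * k : ℂ)

lemma conj_mem_Thimble {ζ p : ℂ} (hp : p ∈ Thimble 0 ζ) :
    (starRingEnd ℂ) p ∈ Thimble 0 ((starRingEnd ℂ) ζ) := by
  obtain ⟨φ, h0, hφ, hlim⟩ := hp
  refine ⟨fun x => (starRingEnd ℂ) (φ x), by simp [h0], fun x hx => ?_, ?_⟩
  · refine ((hφ x hx).star).congr_deriv ?_
    simp [deriv_Wfc, ← Complex.exp_conj]
  · simpa [Function.comp_def] using (Complex.continuous_conj.tendsto _).comp hlim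

lemma apply_mem_Thimble {k : ℤ} {ζ : ℂ} {φ : ℝ → ℂ}
    (hφ : ∀ x : ℝ, x ≤ 0 → HasDerivAt φ (ζ * (starRingEnd ℂ) (deriv Wfc (φ x))) x)
    (hlim : Tendsto φ atBot (nhds (2 * Real.pi * I * k))) {x : ℝ} (hx : x ≤ 0) :
    φ x ∈ Thimble k ζ := by
  refine ⟨fun y => φ (y + x), by simp, fun y hy => ?_, ?_⟩
  · exact (hφ (y + x) (by linarith)).comp_add_const y x
  · exact hlim.comp (tendsto_atBot_add_const_right _ _ tendsto_id)

/-- `W` maps the thimble into a ray of direction `ζ`, with only the critical point over the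
endpoint of the ray. -/
lemma exists_Wfc_eq_of_mem_Thimble {k : ℤ} {ζ p : ℂ} (hζ : ‖ζ‖ = 1) (hp : p ∈ Thimble k ζ) :
    ∃ t : ℝ, 0 ≤ t ∧ Wfc p = -1 + 2 * Real.pi * I * k + t * ζ ∧
      (t = 0 → p = 2 * Real.pi * I * k) := by
  obtain ⟨φ, h0, hφ, hlim⟩ := hp
  have hζζ : (starRingEnd ℂ) ζ * ζ = 1 := by
    rw [mul_comm, Complex.mul_conj, Complex.normSq_eq_norm_sq, hζ]; simp
  set f : ℝ → ℂ := fun x => (starRingEnd ℂ) ζ * (Wfc (φ x) - (-1 + 2 * Real.pi * I * k)) with hf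
  have hfd : ∀ x ≤ 0, HasDerivAt f (((‖1 - Complex.exp (φ x)‖ ^ 2 : ℝ) : ℂ)) x := fun x hx => by
    have h1 := ((hasStrictDerivAt_Wfc (φ x)).hasDerivAt.scomp x (hφ x hx)).sub_const
      (-1 + 2 * Real.pi * I * k : ℂ) |>.const_mul ((starRingEnd ℂ) ζ)
    refine h1.congr_deriv ?_
    rw [deriv_Wfc, ← Complex.normSq_eq_norm_sq, ← Complex.mul_conj, smul_eq_mul]
    linear_combination (1 - Complex.exp (φ x)) * (starRingEnd ℂ) (1 - Complex.exp (φ x)) * hζζ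
  have hflim : Tendsto f atBot (nhds 0) := by
    have hc : Continuous Wfc :=
      continuous_iff_continuousAt.2 fun Y => (hasStrictDerivAt_Wfc Y).hasDerivAt.continuousAt
    have := (((hc.tendsto _).comp hlim).sub_const
      (-1 + 2 * Real.pi * I * k : ℂ)).const_mul ((starRingEnd ℂ) ζ)
    rw [Wfc_two_pi_mul_I, sub_self, mul_zero] at this
    exact this
  have hre : ∀ x ≤ 0, HasDerivAt (fun y => (f y).re) (‖1 - Complex.exp (φ x)‖ ^ 2) x :=
    fun x hx => Complex.reCLM.hasFDerivAt.comp_hasDerivAt x (hfd x hx)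
  have him : ∀ x ≤ 0, HasDerivAt (fun y => (f y).im) 0 x :=
    fun x hx => Complex.imCLM.hasFDerivAt.comp_hasDerivAt x (hfd x hx)
  have hmono : MonotoneOn (fun y => (f y).re) (Set.Iic 0) := by
    refine monotoneOn_of_deriv_nonneg (convex_Iic 0)
      (fun x hx => (hre x hx).continuousAt.continuousWithinAt)
      (fun x hx => (hre x
        (interior_subset (s := Set.Iic 0) hx)).differentiableAt.differentiableWithinAt)
      fun x hx => ?_
    rw [(hre x (interior_subset (s := Set.Iic 0) hx)).deriv]
    positivity
  have himc : ∀ x ≤ 0, (f x).im = (f 0).im := fun x hx =>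
    (constant_of_has_deriv_right_zero (f := fun y => (f y).im) (a := x) (b := 0)
      (fun y hy => (him y hy.2).continuousAt.continuousWithinAt)
      (fun y hy => (him y hy.2.le).hasDerivWithinAt) 0 ⟨hx, le_rfl⟩).symm
  have him0 : (f 0).im = 0 := by
    refine tendsto_nhds_unique (tendsto_const_nhds.congr' ?_)
      ((Complex.continuous_im.tendsto _).comp hflim)
    filter_upwards [eventually_le_atBot 0] with x hx
    exact (himc x hx).symm
  have hnonneg : ∀ x ≤ 0, 0 ≤ (f x).re := fun x hx => by
    refine le_of_tendsto ((Complex.continuous_re.tendsto _).comp hflim) ?_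
    filter_upwards [eventually_le_atBot x] with y hy
    exact hmono (hy.trans hx) hx hy
  have hf0 : f 0 = ((f 0).re : ℂ) := by
    apply Complex.ext <;> simp [him0]
  refine ⟨(f 0).re, hnonneg 0 le_rfl, ?_, fun ht => ?_⟩
  · rw [← hf0, hf]
    simp only [h0]
    linear_combination (-(Wfc p - (-1 + 2 * Real.pi * I * k))) * hζζ
  · have hzero : ∀ x ≤ 0, (f x).re = 0 := fun x hx =>
      le_antisymm (ht ▸ hmono hx Set.self_mem_Iic hx) (hnonneg x hx)
    have hcrit : ∀ x < 0, 1 - Complex.exp (φ x) = 0 := fun x hx => by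
      have h1 : HasDerivAt (fun y => (f y).re) 0 x := by
        refine (hasDerivAt_const x (0 : ℝ)).congr_of_eventuallyEq ?_
        filter_upwards [Iio_mem_nhds hx] with y hy
        exact hzero y (le_of_lt hy)
      simpa using (hre x hx.le).unique h1
    have hφc : ∀ x ≤ 0, φ x = p := fun x hx => by
      rw [← h0]
      refine (constant_of_has_deriv_right_zero (f := φ) (a := x) (b := 0)
        (fun y hy => (hφ y hy.2).continuousAt.continuousWithinAt)
        (fun y hy => ?_) 0 ⟨hx, le_rfl⟩).symm
      have := hφ y hy.2.le
      rw [deriv_Wfc, hcrit y hy.2, map_zero, mul_zero] at this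
      exact this.hasDerivWithinAt
    refine tendsto_nhds_unique (tendsto_const_nhds.congr' ?_) hlim
    filter_upwards [eventually_le_atBot 0] with x hx
    exact (hφc x hx).symm

lemma im_ne_of_mem_Thimble {k : ℤ} {ζ p : ℂ} (hζ : ‖ζ‖ = 1) (him : ζ.im ≠ 0)
    (hp : p ∈ Thimble k ζ) (hpk : p ≠ 2 * Real.pi * I * k) : p.im ≠ 2 * Real.pi * k := by
  intro h
  obtain ⟨t, ht, hW, ht0⟩ := exists_Wfc_eq_of_mem_Thimble hζ hp
  have h1 := congrArg Complex.im hW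
  have hsin : Real.sin (2 * Real.pi * k) = 0 := by
    rw [show 2 * Real.pi * k = ((2 * k : ℤ) : ℝ) * Real.pi by push_cast; ring]
    exact Real.sin_int_mul_pi _
  rw [Wfc_im, h, hsin] at h1
  simp [him] at h1
  exact hpk (ht0 h1)

lemma abs_im_ne_of_mem_Thimble {k : ℤ} {ζ p : ℂ} (hζ : ‖ζ‖ = 1) (hre : 0 < ζ.re)
    (hp : p ∈ Thimble k ζ) : |p.im - 2 * Real.pi * k| ≠ 2 * Real.pi := by
  intro h
  obtain ⟨t, ht, hW, ht0⟩ := exists_Wfc_eq_of_mem_Thimble hζ hp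
  have hcos : Real.cos p.im = 1 := by
    rcases (abs_eq (by positivity)).1 h with h | h
    · rw [show p.im = ((k + 1 : ℤ) : ℝ) * (2 * Real.pi) by push_cast; linarith]
      exact Real.cos_int_mul_two_pi _
    · rw [show p.im = ((k - 1 : ℤ) : ℝ) * (2 * Real.pi) by push_cast; linarith]
      exact Real.cos_int_mul_two_pi _
  have h1 := congrArg Complex.re hW
  rw [Wfc_re, hcos] at h1
  simp at h1
  have h2 := Real.add_one_le_exp p.re
  have h3 : t = 0 := by nlinarith
  rw [ht0 h3] at h
  simp at h

lemma abs_im_lt_of_mem_Thimble {k : ℤ} {ζ p : ℂ} (hζ : ‖ζ‖ = 1) (hre : 0 < ζ.re)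
    (hp : p ∈ Thimble k ζ) : |p.im - 2 * Real.pi * k| < 2 * Real.pi := by
  by_contra! hc
  obtain ⟨φ, h0, hφ, hlim⟩ := hp
  have hlim' : Tendsto (fun x => |(φ x).im - 2 * Real.pi * k|) atBot (nhds 0) := by
    have := (((Complex.continuous_im.tendsto _).comp hlim).sub_const (2 * Real.pi * k)).abs
    simpa using this
  obtain ⟨x, hx, hx0⟩ := ((hlim'.eventually_lt_const
    (show (0 : ℝ) < 2 * Real.pi by positivity)).and (eventually_le_atBot 0)).exists
  have hcont : ContinuousOn (fun x => |(φ x).im - 2 * Real.pi * k|) (Set.Icc x 0) := by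
    have : ContinuousOn φ (Set.Icc x 0) :=
      fun y hy => (hφ y hy.2).continuousAt.continuousWithinAt
    fun_prop
  obtain ⟨y, hy, hy2⟩ := intermediate_value_Icc hx0 hcont ⟨hx.le, by rwa [h0]⟩
  exact abs_im_ne_of_mem_Thimble hζ hre (apply_mem_Thimble hφ hlim hy.2) hy2

lemma sub_exp_ne_zero {Y : ℂ} (hY : Y.im ∈ Set.Ioo 0 (2 * Real.pi)) : 1 - Complex.exp Y ≠ 0 := by
  intro h
  obtain ⟨n, hn⟩ := Complex.exp_eq_one_iff.1 (sub_eq_zero.1 h).symm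
  have him : Y.im = n * (2 * Real.pi) := by rw [hn]; simp
  rw [him] at hY
  have hpi := Real.pi_pos
  have h0 : (0 : ℝ) < n := by
    by_contra! hc
    nlinarith [hY.1]
  have h1 : (n : ℝ) < 1 := by
    by_contra! hc
    nlinarith [hY.2]
  have h0' : 0 < n := by exact_mod_cast h0
  have h1' : n < 1 := by exact_mod_cast h1
  omega

/-- The real part of `(exp Y - 1 - Y) / Y ^ 2 = ∫ s in 0..1, (1 - s) * exp (s * Y)` is bounded
below on a half-strip. -/
lemma le_re_exp_sub_one_sub_div_sq {Y : ℂ} (hre : -1 ≤ Y.re) (him0 : 0 < Y.im)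
    (him1 : Y.im ≤ Real.pi / 2) :
    Real.exp (-1) / 3 ≤ ((Complex.exp Y - 1 - Y) / Y ^ 2).re := by
  have hY : Y ≠ 0 := by
    rintro rfl
    simp at him0
  set P : ℝ → ℂ := fun s =>
    (1 - s) * Complex.exp (s * Y) / Y + Complex.exp (s * Y) / Y ^ 2 with hP
  have hPd : ∀ s : ℝ, HasDerivAt P ((1 - s) * Complex.exp (s * Y)) s := fun s => by
    have h1 : HasDerivAt (fun s : ℝ => (s : ℂ)) 1 s := Complex.ofRealCLM.hasDerivAt
    have h2 := (h1.mul_const Y).cexp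
    refine ((((h1.const_sub 1).mul h2).div_const Y).add (h2.div_const (Y ^ 2))).congr_deriv ?_
    field_simp
    ring
  set Q : ℝ → ℝ := fun s => (P s).re + Real.exp (-1) * (1 - s) ^ 3 / 3 with hQ
  have hQd : ∀ s : ℝ, HasDerivAt Q
      (((1 - s) * Complex.exp (s * Y)).re - Real.exp (-1) * (1 - s) ^ 2) s := fun s => by
    have h1 : HasDerivAt (fun s => (P s).re) (((1 - s) * Complex.exp (s * Y)).re) s :=
      Complex.reCLM.hasFDerivAt.comp_hasDerivAt s (hPd s)
    have h2 := (((hasDerivAt_id s).const_sub 1).pow 3).const_mul (Real.exp (-1)) |>.div_const 3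
    refine (h1.add h2).congr_deriv ?_
    simp
    ring
  have hmono : MonotoneOn Q (Set.Icc 0 1) := by
    refine monotoneOn_of_deriv_nonneg (convex_Icc 0 1)
      (fun s _ => (hQd s).continuousAt.continuousWithinAt)
      (fun s _ => (hQd s).differentiableAt.differentiableWithinAt) fun s hs => ?_
    rw [interior_Icc] at hs
    obtain ⟨hs0, hs1⟩ := hs
    have hcalc : ((1 - s) * Complex.exp (s * Y)).re
        = (1 - s) * (Real.exp (s * Y.re) * Real.cos (s * Y.im)) := by
      rw [show (1 - s : ℂ) = ((1 - s : ℝ) : ℂ) by push_cast; rfl, Complex.re_ofReal_mul,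
        Complex.exp_re]
      simp
    have hexp : Real.exp (-1) ≤ Real.exp (s * Y.re) := Real.exp_le_exp.2 (by nlinarith)
    have hcos : 1 - s ≤ Real.cos (s * Y.im) := by
      refine le_trans ?_ (Real.one_sub_mul_le_cos (by positivity) (by nlinarith))
      have : 2 / Real.pi * (s * Y.im) ≤ 2 / Real.pi * (s * (Real.pi / 2)) := by gcongr
      have h2 : 2 / Real.pi * (s * (Real.pi / 2)) = s := by field_simp
      linarith
    rw [(hQd s).deriv, hcalc, sub_nonneg]
    have h1s : 0 < 1 - s := by linarith
    calc Real.exp (-1) * (1 - s) ^ 2 = (1 - s) * (Real.exp (-1) * (1 - s)) := by ring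
      _ ≤ (1 - s) * (Real.exp (s * Y.re) * Real.cos (s * Y.im)) := by gcongr
  have h01 := hmono (Set.left_mem_Icc.2 zero_le_one) (Set.right_mem_Icc.2 zero_le_one) zero_le_one
  have hdiff : (Complex.exp Y - 1 - Y) / Y ^ 2 = P 1 - P 0 := by
    simp [hP]
    field_simp
    ring
  rw [hdiff, Complex.sub_re]
  simp only [hQ] at h01
  norm_num at h01
  linarith

lemma sq_norm_le_of_im_mem_Ioo {Y : ℂ} (hY : Y.im ∈ Set.Ioo 0 (2 * Real.pi))
    (hre0 : 0 ≤ (Wfc Y + 1).re) (hre1 : (Wfc Y + 1).re ≤ 1) (him : (Wfc Y + 1).im ≤ 1 / 2) :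
    ‖Y‖ ^ 2 ≤ 9 * ‖Wfc Y + 1‖ := by
  have hpi := Real.pi_gt_three
  have hYpi : Y.im < Real.pi :=
    im_lt_pi_of_Wfc_im_lt_pi (by simp at him; linarith) hY.2
  have hs := Real.sin_pos_of_pos_of_lt_pi hY.1 hYpi
  have he := Real.exp_pos Y.re
  simp only [Complex.add_re, Complex.add_im, Complex.one_re, Complex.one_im, Wfc_re, Wfc_im]
    at hre0 hre1 him
  have hhalf : Y.im < Real.pi / 2 := by
    by_contra! hc
    have hcos : Real.cos Y.im ≤ 0 := Real.cos_nonpos_of_pi_div_two_le_of_le hc (by linarith)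
    have h1 : Real.exp Y.re ≤ 1 := Real.exp_le_one_iff.2 (by nlinarith)
    have := Real.sin_le_one Y.im
    nlinarith
  have hcos : 0 < Real.cos Y.im := Real.cos_pos_of_mem_Ioo ⟨by linarith [hY.1], hhalf⟩
  have hx : -1 ≤ Y.re := by nlinarith
  have hle := (le_re_exp_sub_one_sub_div_sq hx hY.1 hhalf.le).trans (Complex.re_le_norm _)
  have hq : ‖Complex.exp Y - 1 - Y‖ = ‖Wfc Y + 1‖ := by
    rw [← norm_neg, Wfc]
    congr 1
    ring
  have hY0 : 0 < ‖Y‖ := norm_pos_iff.2 (by rintro rfl; simp at hY)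
  rw [norm_div, hq, norm_pow, le_div_iff₀ (by positivity)] at hle
  have h3 : 1 / 3 ≤ Real.exp (-1) := by
    rw [Real.exp_neg, one_div]
    exact inv_anti₀ (Real.exp_pos 1) (by linarith [Real.exp_one_lt_d9])
  nlinarith [sq_nonneg ‖Y‖]

/-- The ray of direction `ζ` through the critical value lifts to a flow line emanating from the
critical point `0`. -/
lemma mem_Thimble_of_Wfc_eq {ζ p : ℂ} {T : ℝ} (hζ : ‖ζ‖ = 1) (hre : 0 < ζ.re) (him : 0 < ζ.im)
    (hT : 0 < T) (hT' : T * ζ.im < 2 * Real.pi) (hp : p.im ∈ Set.Ioo 0 (2 * Real.pi))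
    (hW : Wfc p = -1 + T * ζ) : p ∈ Thimble 0 ζ := by
  choose! g hg using fun (w : ℂ) (h : w.im ∈ Set.Ioo 0 (2 * Real.pi)) =>
    existsUnique_Wfc_eq h.1 h.2
  have hstrip : ∀ a b : ℝ, IsOpen {Y : ℂ | Y.im ∈ Set.Ioo a b} := fun a b =>
    isOpen_Ioo.preimage Complex.continuous_im
  have hgc : ∀ w : ℂ, w.im ∈ Set.Ioo 0 (2 * Real.pi) → ContinuousAt g w := by
    intro w hw
    obtain ⟨⟨hgw, hWg⟩, -⟩ := hg w hw
    refine fun U hU => mem_map.2 ?_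
    have hV := (hasStrictDerivAt_Wfc (g w)).map_nhds_eq (sub_exp_ne_zero hgw)
    rw [hWg] at hV
    have hmem : Wfc '' (U ∩ {Y : ℂ | Y.im ∈ Set.Ioo 0 (2 * Real.pi)}) ∈ nhds w := by
      rw [← hV]
      exact image_mem_map (inter_mem hU ((hstrip _ _).mem_nhds hgw))
    filter_upwards [hmem, (hstrip _ _).mem_nhds hw] with w' hw' hw's
    obtain ⟨Y, ⟨hYU, hYs⟩, rfl⟩ := hw'
    rw [Set.mem_preimage, ← (hg _ hw's).2 Y ⟨hYs, rfl⟩]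
    exact hYU
  have hgd : ∀ w : ℂ, w.im ∈ Set.Ioo 0 (2 * Real.pi) →
      HasDerivAt g (1 - Complex.exp (g w))⁻¹ w := fun w hw => by
    refine HasDerivAt.of_local_left_inverse (hgc w hw) (hasStrictDerivAt_Wfc _).hasDerivAt
      (sub_exp_ne_zero (hg w hw).1.1) ?_
    filter_upwards [(hstrip _ _).mem_nhds hw] with w' hw'
    exact (hg w' hw').1.2
  have hray : ∀ v ≤ Real.log T,
      (-1 + (Real.exp v : ℂ) * ζ).im ∈ Set.Ioo 0 (2 * Real.pi) := fun v hv => by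
    have h1 : Real.exp v ≤ T := by rwa [← Real.le_log_iff_exp_le hT]
    have h2 : (-1 + (Real.exp v : ℂ) * ζ).im = Real.exp v * ζ.im := by
      rw [Complex.add_im, Complex.im_ofReal_mul]; simp
    rw [h2]
    exact ⟨by positivity, by nlinarith⟩
  have hsmall : ∀ v ≤ Real.log T, v ≤ Real.log (1 / 2) →
      ‖g (-1 + (Real.exp v : ℂ) * ζ)‖ ^ 2 ≤ 9 * Real.exp v := fun v hv hv' => by
    have hgv := (hg _ (hray v hv)).1
    have hq : Wfc (g (-1 + (Real.exp v : ℂ) * ζ)) + 1 = (Real.exp v : ℂ) * ζ := by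
      rw [hgv.2]; ring
    have he : Real.exp v ≤ 1 / 2 := by rwa [← Real.le_log_iff_exp_le (by norm_num)]
    have hr : ζ.re ≤ 1 := hζ ▸ Complex.re_le_norm ζ
    have hi : ζ.im ≤ 1 := hζ ▸ Complex.im_le_norm ζ
    have hpos := Real.exp_pos v
    have := sq_norm_le_of_im_mem_Ioo hgv.1
      (by rw [hq, Complex.re_ofReal_mul]; positivity)
      (by rw [hq, Complex.re_ofReal_mul]; nlinarith)
      (by rw [hq, Complex.im_ofReal_mul]; nlinarith)
    rwa [hq, norm_mul, hζ, Complex.norm_real, Real.norm_of_nonneg hpos.le, mul_one] at this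
  set K : ℝ → ℝ := fun v =>
    ‖1 - Complex.exp (g (-1 + (Real.exp (min v (Real.log T)) : ℂ) * ζ))‖ ^ 2 /
      Real.exp (min v (Real.log T)) with hK
  have hKc : Continuous K := by
    have h1 : Continuous fun v : ℝ => g (-1 + (Real.exp (min v (Real.log T)) : ℂ) * ζ) := by
      refine continuous_iff_continuousAt.2 fun v => ?_
      exact ContinuousAt.comp' (hgc _ (hray _ (min_le_right _ _))) (by fun_prop)
    exact Continuous.div (((continuous_const.sub h1.cexp).norm).pow 2) (by fun_prop)
      fun v => (Real.exp_pos _).ne'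
  have hKpos : ∀ v, 0 < K v := fun v => by
    have := norm_pos_iff.2 (sub_exp_ne_zero (hg _ (hray _ (min_le_right v _))).1.1)
    positivity
  have hKle : ∀ v ≤ Real.log T, v ≤ Real.log (1 / 2) → K v ≤ 20 := fun v hv hv' => by
    have h1 := hsmall v hv hv'
    have hgv := (hg _ (hray v hv)).1
    have he : Real.exp v ≤ 1 / 2 := by rwa [← Real.le_log_iff_exp_le (by norm_num)]
    have hpos := Real.exp_pos v
    simp only [hK, min_eq_left hv]
    rw [div_le_iff₀ hpos]
    set Y := g (-1 + (Real.exp v : ℂ) * ζ) with hY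
    have h2 : 1 - Complex.exp Y = (Real.exp v : ℂ) * ζ - Y := by
      have := hgv.2
      rw [Wfc] at this
      linear_combination this
    have h3 : ‖1 - Complex.exp Y‖ ≤ Real.exp v + ‖Y‖ := by
      rw [h2]
      refine (norm_sub_le _ _).trans ?_
      rw [norm_mul, hζ, Complex.norm_real, Real.norm_of_nonneg hpos.le, mul_one]
    calc ‖1 - Complex.exp Y‖ ^ 2 ≤ (Real.exp v + ‖Y‖) ^ 2 := by gcongr
      _ ≤ 20 * Real.exp v := by nlinarith [sq_nonneg (Real.exp v - ‖Y‖)]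
  set G : ℝ → ℝ := fun v => ∫ u in (Real.log T)..v, (K u)⁻¹ with hG
  have hGd : ∀ v, HasDerivAt G (K v)⁻¹ v := fun v =>
    ((hKc.inv₀ fun u => (hKpos u).ne').integral_hasStrictDerivAt (Real.log T) v).hasDerivAt
  have hGm : StrictMono G := strictMono_of_deriv_pos fun v => by
    rw [(hGd v).deriv]; exact inv_pos.2 (hKpos v)
  have hGcont : Continuous G := continuous_iff_continuousAt.2 fun v => (hGd v).continuousAt
  have hgrow : ∀ (D : Set ℝ) (c : ℝ), Convex ℝ D → (∀ v ∈ D, K v ≤ c) →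
      ∀ x ∈ D, ∀ y ∈ D, x ≤ y → c⁻¹ * (y - x) ≤ G y - G x := fun D c hD hc =>
    hD.mul_sub_le_image_sub_of_le_deriv hGcont.continuousOn
      (fun v _ => (hGd v).differentiableAt.differentiableWithinAt) fun v hv => by
        rw [(hGd v).deriv]
        exact inv_anti₀ (hKpos v) (hc v (interior_subset hv))
  have hGtop : Tendsto G atTop atTop := by
    have hc : ∀ v ∈ Set.Ici (Real.log T), K v ≤ K (Real.log T) := fun v hv => by
      have : min v (Real.log T) = Real.log T := min_eq_right hv
      simp [hK, this]
    have h1 : Tendsto (fun v => (K (Real.log T))⁻¹ * (v - Real.log T) + G (Real.log T))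
        atTop atTop :=
      tendsto_atTop_add_const_right _ _
        ((tendsto_atTop_add_const_right _ _ tendsto_id).const_mul_atTop (inv_pos.2 (hKpos _)))
    refine tendsto_atTop_mono' _ ?_ h1
    filter_upwards [eventually_ge_atTop (Real.log T)] with v hv
    linarith [hgrow _ _ (convex_Ici _) hc _ Set.self_mem_Ici v hv hv]
  have hGbot : Tendsto G atBot atBot := by
    set v₁ := min (Real.log T) (Real.log (1 / 2)) with hv₁
    have hc : ∀ v ∈ Set.Iic v₁, K v ≤ 20 := fun v hv =>
      hKle v (le_trans hv (min_le_left _ _)) (le_trans hv (min_le_right _ _))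
    have h1 : Tendsto (fun v => (20 : ℝ)⁻¹ * (v - v₁) + G v₁) atBot atBot :=
      tendsto_atBot_add_const_right _ _
        ((tendsto_atBot_add_const_right _ _ tendsto_id).const_mul_atBot (by norm_num))
    refine tendsto_atBot_mono' _ ?_ h1
    filter_upwards [eventually_le_atBot v₁] with v hv
    linarith [hgrow _ _ (convex_Iic _) hc v hv _ Set.self_mem_Iic hv]
  set e := hGm.orderIsoOfSurjective G (hGcont.surjective hGtop hGbot) with he
  set V : ℝ → ℝ := fun x => e.symm x with hV
  have hGV : ∀ x, G (V x) = x := e.apply_symm_apply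
  have hV0 : V 0 = Real.log T := by
    apply hGm.injective
    rw [hGV]
    simp [hG]
  have hVle : ∀ x ≤ 0, V x ≤ Real.log T := fun x hx => hV0 ▸ e.symm.monotone hx
  have hVd : ∀ x, HasDerivAt V (K (V x)) x := fun x => by
    have := HasDerivAt.of_local_left_inverse (g := V) e.symm.continuous.continuousAt (hGd (V x))
      (inv_pos.2 (hKpos _)).ne' (Eventually.of_forall hGV)
    rwa [inv_inv] at this
  have hVbot : Tendsto V atBot atBot := e.symm.tendsto_atBot
  refine ⟨fun x => g (-1 + (Real.exp (V x) : ℂ) * ζ), ?_, fun x hx => ?_, ?_⟩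
  · have h := hray (V 0) hV0.le
    simp only [hV0, Real.exp_log hT] at h ⊢
    exact ((hg _ h).2 p ⟨hp, hW⟩).symm
  · have hr := hray _ (hVle x hx)
    have h1 := (((hVd x).exp.ofReal_comp).mul_const ζ).const_add (-1)
    refine ((hgd _ hr).scomp x h1).congr_deriv ?_
    have hne := sub_exp_ne_zero (hg _ hr).1.1
    have hKV : Real.exp (V x) * K (V x)
        = ‖1 - Complex.exp (g (-1 + (Real.exp (V x) : ℂ) * ζ))‖ ^ 2 := by
      simp only [hK, min_eq_left (hVle x hx)]
      field_simp
    rw [hKV, deriv_Wfc, ← Complex.normSq_eq_norm_sq, ← Complex.mul_conj, smul_eq_mul]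
    field_simp
  · simp only [Int.cast_zero, mul_zero]
    rw [tendsto_zero_iff_norm_tendsto_zero]
    have h1 : Tendsto (fun x => ‖g (-1 + (Real.exp (V x) : ℂ) * ζ)‖ ^ 2) atBot (nhds 0) := by
      have h2 : Tendsto (fun x => 9 * Real.exp (V x)) atBot (nhds 0) := by
        simpa using (Real.tendsto_exp_atBot.comp hVbot).const_mul 9
      refine squeeze_zero' (Eventually.of_forall fun x => by positivity) ?_ h2
      filter_upwards [hVbot.eventually_le_atBot (Real.log T),
        hVbot.eventually_le_atBot (Real.log (1 / 2))] with x hx hx'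
      exact hsmall _ hx hx'
    simpa using h1.sqrt

theorem stmt_3 (θ θ' : ℝ) (hθ : θ ∈ Set.Ioo 0 (Real.pi / 2))
    (hθ' : θ' ∈ Set.Ioo 0 (Real.pi / 2)) (k l : ℤ) :
    (k = l ∨ k = l + 1 →
      ∃! p : ℂ, p ∈ Thimble k (Complex.exp (-(θ' : ℂ) * Complex.I)) ∩
        Thimble l (Complex.exp ((θ : ℂ) * Complex.I))) ∧
    (¬ (k = l ∨ k = l + 1) →
      Thimble k (Complex.exp (-(θ' : ℂ) * Complex.I)) ∩
        Thimble l (Complex.exp ((θ : ℂ) * Complex.I)) = ∅) := by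
  have hpi := Real.pi_pos
  have hconj : Complex.exp (-(θ' : ℂ) * Complex.I)
      = (starRingEnd ℂ) (Complex.exp ((θ' : ℂ) * Complex.I)) := by
    rw [← Complex.exp_conj]; simp
  have hs : 0 < Real.sin θ := Real.sin_pos_of_pos_of_lt_pi hθ.1 (by linarith [hθ.2])
  have hs' : 0 < Real.sin θ' := Real.sin_pos_of_pos_of_lt_pi hθ'.1 (by linarith [hθ'.2])
  have hc : 0 < Real.cos θ := Real.cos_pos_of_mem_Ioo ⟨by linarith [hθ.1], hθ.2⟩
  have hc' : 0 < Real.cos θ' := Real.cos_pos_of_mem_Ioo ⟨by linarith [hθ'.1], hθ'.2⟩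
  have hre := Complex.exp_ofReal_mul_I_re θ
  have him := Complex.exp_ofReal_mul_I_im θ
  have hn := Complex.norm_exp_ofReal_mul_I θ
  have hre' := Complex.exp_ofReal_mul_I_re θ'
  have him' := Complex.exp_ofReal_mul_I_im θ'
  have hn' := Complex.norm_exp_ofReal_mul_I θ'
  rw [hconj]
  generalize Complex.exp ((θ : ℂ) * Complex.I) = ζ at *
  generalize Complex.exp ((θ' : ℂ) * Complex.I) = ζ' at *
  generalize Real.sin θ = a at *
  generalize Real.cos θ = c at *
  generalize Real.sin θ' = a' at *
  generalize Real.cos θ' = c' at *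
  have hnc : ‖(starRingEnd ℂ) ζ'‖ = 1 := by simpa using hn'
  have hrec : 0 < ((starRingEnd ℂ) ζ').re := by simpa [hre'] using hc'
  have himc : ((starRingEnd ℂ) ζ').im ≠ 0 := by simpa [him'] using hs'.ne'
  have hrel : ∀ p ∈ Thimble k ((starRingEnd ℂ) ζ') ∩ Thimble l ζ, ∃ s t : ℝ, 0 ≤ s ∧ 0 ≤ t ∧
      s * c' = t * c ∧ s * a' + t * a = 2 * Real.pi * (k - l) ∧
      Wfc p = -1 + 2 * Real.pi * I * l + t * ζ ∧ (t = 0 → p = 2 * Real.pi * I * l) := by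
    rintro p ⟨hp, hp'⟩
    obtain ⟨s, hs0, hsW, -⟩ := exists_Wfc_eq_of_mem_Thimble hnc hp
    obtain ⟨t, ht0, htW, ht⟩ := exists_Wfc_eq_of_mem_Thimble hn hp'
    have h := hsW.symm.trans htW
    have h1 := congrArg Complex.re h
    have h2 := congrArg Complex.im h
    simp [hre, him, hre', him'] at h1 h2
    exact ⟨s, t, hs0, ht0, h1, by linarith, htW, ht⟩
  have habs : ∀ p ∈ Thimble k ((starRingEnd ℂ) ζ') ∩ Thimble l ζ,
      2 * Real.pi * (k - 1) < p.im ∧ p.im < 2 * Real.pi * (l + 1) := fun p hp => by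
    have h1 := abs_lt.1 (abs_im_lt_of_mem_Thimble hnc hrec hp.1)
    have h2 := abs_lt.1 (abs_im_lt_of_mem_Thimble hn (hre ▸ hc) hp.2)
    constructor <;> linarith
  refine ⟨?_, fun hkl => Set.eq_empty_iff_forall_notMem.2 fun p hp => hkl ?_⟩
  · rintro (rfl | rfl)
    · refine ⟨2 * Real.pi * I * k, ⟨mem_Thimble_self k _, mem_Thimble_self k _⟩, fun p hp => ?_⟩
      obtain ⟨s, t, hs0, ht0, -, h2, -, ht⟩ := hrel p hp
      refine ht ?_
      rw [sub_self, mul_zero] at h2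
      have : 0 ≤ s * a' := by positivity
      nlinarith
    · have hd : 0 < a' * c + a * c' := by positivity
      set T := 2 * Real.pi * c' / (a' * c + a * c') with hT
      set S := 2 * Real.pi * c / (a' * c + a * c') with hS
      have hT0 : 0 < T := by positivity
      have hS0 : 0 < S := by positivity
      have hST : S * a' + T * a = 2 * Real.pi := by
        rw [hS, hT]; field_simp
      have hSTc : S * c' = T * c := by
        rw [hS, hT]; field_simp
      have hTa : T * a < 2 * Real.pi := by nlinarith
      have hSa : S * a' < 2 * Real.pi := by nlinarith
      have hTim : (-1 + (T : ℂ) * ζ).im = T * a := by simp [him]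
      obtain ⟨q, ⟨hq, hqW⟩, hquniq⟩ := existsUnique_Wfc_eq (w := -1 + T * ζ)
        (by rw [hTim]; positivity) (by rw [hTim]; exact hTa)
      refine ⟨q + 2 * Real.pi * I * l, ⟨?_, ?_⟩, fun p hp => ?_⟩
      · have hr : (starRingEnd ℂ) q + 2 * Real.pi * I ∈ Thimble 0 ζ' := by
          refine mem_Thimble_of_Wfc_eq hn' (hre' ▸ hc') (him' ▸ hs') hS0 (him' ▸ hSa) ?_ ?_
          · simpa using hq.symm
          · have h := Wfc_add_two_pi_mul_I ((starRingEnd ℂ) q) 1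
            rw [Int.cast_one, mul_one] at h
            rw [h, Wfc_conj, hqW]
            apply Complex.ext
            · simp [hre, hre', hSTc]
            · simp [him, him']
              linarith
        have h := add_mem_Thimble (conj_mem_Thimble hr) (l + 1)
        convert h using 1
        simp [Complex.conj_ofNat]
        ring
      · exact add_mem_Thimble (mem_Thimble_of_Wfc_eq hn (hre ▸ hc) (him ▸ hs) hT0 (him ▸ hTa)
          hq hqW) l
      · obtain ⟨s, t, hs0, ht0, h1, h2, hpW, ht⟩ := hrel p hp
        have htT : t = T := by
          rw [hT, eq_div_iff hd.ne']
          push_cast at h2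
          linear_combination c' * h2 - a' * h1
        obtain ⟨h3, h4⟩ := habs p hp
        have h5 := (abs_lt.1 (abs_im_lt_of_mem_Thimble hnc hrec hp.1)).1
        push_cast at h3 h5
        have hpl : p ≠ 2 * Real.pi * I * l := by
          rintro rfl
          simp at h5
          linarith
        have h6 := im_ne_of_mem_Thimble hn (him ▸ hs.ne') hp.2 hpl
        have h7 : 2 * Real.pi * l < p.im := lt_of_le_of_ne (by linarith) h6.symm
        rw [← hquniq (p - 2 * Real.pi * I * l) ⟨⟨?_, ?_⟩, ?_⟩]
        · ring
        · simpa using h7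
        · simp
          linarith
        · have h := Wfc_add_two_pi_mul_I (p - 2 * Real.pi * I * l) l
          rw [sub_add_cancel, hpW, htT] at h
          linear_combination -h
  · obtain ⟨s, t, hs0, ht0, -, h2, -, -⟩ := hrel p hp
    obtain ⟨h3, h4⟩ := habs p hp
    have h5 : (0 : ℝ) ≤ k - l := by
      by_contra! h
      have : 0 ≤ s * a' + t * a := by positivity
      nlinarith
    have h6 : (k : ℝ) - 1 < l + 1 := lt_of_mul_lt_mul_left (h3.trans h4) (by positivity)
    have h5' : l ≤ k := by exact_mod_cast sub_nonneg.1 h5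
    have h6' : k - 1 < l + 1 := by exact_mod_cast h6
    omega
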